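/- Let V₀ be a finite-dimensional Euclidean vector space with complexification V, and let W be a finite group generated by reflections on V₀, acting on V and hence on functions by (w·f)(λ) = f(w⁻¹λ). Then there exist homogeneous complex polynomials p₁, …, p_{|W|} on V such that every f ∈ PW(V) can be written uniquely as f = Σᵢ pᵢ fᵢ with each fᵢ ∈ PW(V)^W, the W-invariant elements of PW(V). -/

import Mathlib

noncomputable section

def reOf {n : ℕ} (l : Fin n → ℂ) : Fin n → ℝ := fun i => (l i).re

def IsPW {n : ℕ} (f : (Fin n → ℂ) → ℂ) : Prop :=
  Differentiable ℂ f ∧ ∀ (N : ℕ) (k : ℝ), ∃ C : ℝ, ∀ l : Fin n → ℂ,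
    ‖reOf l‖ ≤ k → (1 + ‖l‖) ^ N * ‖f l‖ ≤ C

/-- A complex reflection: an involution whose `-1` eigenspace (the range of `T - 1`)
is one-dimensional. -/
def IsReflection {n : ℕ} (T : (Fin n → ℂ) →ₗ[ℂ] (Fin n → ℂ)) : Prop :=
  T ∘ₗ T = LinearMap.id ∧ T ≠ LinearMap.id ∧
    Module.finrank ℂ (LinearMap.range (T - LinearMap.id)) = 1

/-- `T` is the complexification of a real orthogonal map: it preserves the real points
and the complexified Euclidean quadratic form. -/
def PreservesRealForm {n : ℕ} (T : (Fin n → ℂ) →ₗ[ℂ] (Fin n → ℂ)) : Prop :=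
  (∀ l : Fin n → ℂ, (∀ i, (l i).im = 0) → ∀ i, (T l i).im = 0) ∧
  (∀ l : Fin n → ℂ, ∑ i, (T l i) ^ 2 = ∑ i, (l i) ^ 2)

open MvPolynomial

section InvariantTheory

variable {n : ℕ} {G : Type} [Group G]

local notation "S" => MvPolynomial (Fin n) ℂ

/-- `r` is fixed by every operator `σ g`. -/
def IsInvariantUnder (σ : G →* (MvPolynomial (Fin n) ℂ →ₐ[ℂ] MvPolynomial (Fin n) ℂ))
    (r : MvPolynomial (Fin n) ℂ) : Prop :=
  ∀ g, σ g r = r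

/-- The Hilbert ideal: generated by the invariants without constant term. -/
def hilbertIdeal (σ : G →* (MvPolynomial (Fin n) ℂ →ₐ[ℂ] MvPolynomial (Fin n) ℂ)) :
    Ideal (MvPolynomial (Fin n) ℂ) :=
  Ideal.span {r | IsInvariantUnder σ r ∧ constantCoeff r = 0}

/-- `σ` preserves degrees and `G` is generated by elements `s` such that `σ s - 1` is
divisible by a nonzero linear form. -/
structure IsReflectionAction
    (σ : G →* (MvPolynomial (Fin n) ℂ →ₐ[ℂ] MvPolynomial (Fin n) ℂ)) : Prop where
  homogeneous : ∀ g p d, p.IsHomogeneous d → (σ g p).IsHomogeneous d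
  generated : ∃ T : Set G, Subgroup.closure T = ⊤ ∧ ∀ s ∈ T,
    ∃ L : MvPolynomial (Fin n) ℂ, L.IsHomogeneous 1 ∧ L ≠ 0 ∧ ∀ p, ∃ q, σ s p - p = L * q

lemma homogeneousComponent_mul_of_isHomogeneous (g p : S) {d e : ℕ} (hp : p.IsHomogeneous e) :
    homogeneousComponent d (g * p) =
      if e ≤ d then homogeneousComponent (d - e) g * p else 0 := by
  conv_lhs => rw [← sum_homogeneousComponent g, Finset.sum_mul, map_sum]
  have h : ∀ k, homogeneousComponent d (homogeneousComponent k g * p) =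
      if d = k + e then homogeneousComponent k g * p else 0 := fun k =>
    homogeneousComponent_of_mem ((mem_homogeneousSubmodule _ _).2
      ((homogeneousComponent_isHomogeneous k g).mul hp))
  rw [Finset.sum_congr rfl fun k _ => h k]
  split_ifs with hed
  · have h' : ∀ k, d = k + e ↔ d - e = k := fun k => by omega
    simp_rw [h', Finset.sum_ite_eq]
    split_ifs with hd
    · rfl
    · rw [homogeneousComponent_eq_zero _ _ (by simp at hd; omega), zero_mul]
  · exact Finset.sum_eq_zero fun k _ => if_neg (by omega)

variable {σ : G →* (MvPolynomial (Fin n) ℂ →ₐ[ℂ] MvPolynomial (Fin n) ℂ)}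

namespace IsInvariantUnder

lemma zero : IsInvariantUnder σ 0 := fun g => map_zero (σ g)

lemma add {a b : S} (ha : IsInvariantUnder σ a) (hb : IsInvariantUnder σ b) :
    IsInvariantUnder σ (a + b) := fun g => by rw [map_add, ha, hb]

lemma mul {a b : S} (ha : IsInvariantUnder σ a) (hb : IsInvariantUnder σ b) :
    IsInvariantUnder σ (a * b) := fun g => by rw [map_mul, ha, hb]

lemma C (c : ℂ) : IsInvariantUnder σ (C c : S) := fun g => by
  simp

lemma sub {a b : S} (ha : IsInvariantUnder σ a) (hb : IsInvariantUnder σ b) :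
    IsInvariantUnder σ (a - b) := fun g => by rw [map_sub, ha, hb]

lemma sum_orbit [Fintype G] (σ : G →* (MvPolynomial (Fin n) ℂ →ₐ[ℂ] MvPolynomial (Fin n) ℂ))
    (a : S) :
    IsInvariantUnder σ (∑ g, σ g a) := fun h => by
  rw [map_sum]
  simp_rw [← AlgHom.mul_apply, ← map_mul]
  exact Fintype.sum_equiv (Equiv.mulLeft h) _ _ fun _ => rfl

lemma homogeneousComponent (hσ : IsReflectionAction σ) {a : S} (ha : IsInvariantUnder σ a)
    (d : ℕ) : IsInvariantUnder σ (homogeneousComponent d a) := fun g => by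
  have h : MvPolynomial.homogeneousComponent d (σ g a) =
      σ g (MvPolynomial.homogeneousComponent d a) := by
    conv_lhs => rw [← sum_homogeneousComponent a, map_sum, map_sum]
    have : ∀ k, MvPolynomial.homogeneousComponent d (σ g (MvPolynomial.homogeneousComponent k a)) =
        if k = d then σ g (MvPolynomial.homogeneousComponent d a) else 0 := fun k => by
      rw [homogeneousComponent_of_mem ((mem_homogeneousSubmodule _ _).2
        (hσ.homogeneous g _ k (homogeneousComponent_isHomogeneous k a)))]
      by_cases hk : k = d
      · simp [hk]
      · simp [hk, Ne.symm hk]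
    rw [Finset.sum_congr rfl fun k _ => this k, Finset.sum_ite_eq']
    split_ifs with hd
    · rfl
    · rw [homogeneousComponent_eq_zero _ _ (by simpa using hd), map_zero]
  rw [← h, ha]

end IsInvariantUnder

lemma map_mem_hilbertIdeal (g : G) {x : S} (hx : x ∈ hilbertIdeal σ) :
    σ g x ∈ hilbertIdeal σ := by
  induction hx using Submodule.span_induction with
  | mem x hx => rw [hx.1 g]; exact Ideal.subset_span hx
  | zero => simp
  | add x y _ _ hx hy => rw [map_add]; exact add_mem hx hy
  | smul a x _ hx => rw [smul_eq_mul, map_mul]; exact Ideal.mul_mem_left _ _ hx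

variable [Fintype G]

lemma mem_hilbertIdeal_of_card_mul_mem {p : S}
    (h : C (Fintype.card G : ℂ) * p ∈ hilbertIdeal σ) : p ∈ hilbertIdeal σ := by
  have := Ideal.mul_mem_left _ (C (Fintype.card G : ℂ)⁻¹) h
  rwa [← mul_assoc, ← C_mul, inv_mul_cancel₀ (by simp), C_1, one_mul] at this

lemma mem_hilbertIdeal_of_forall_sub_mem (hσ : IsReflectionAction σ) {p : S} {d : ℕ}
    (hp : p.IsHomogeneous (d + 1)) {T : Set G} (hT : Subgroup.closure T = ⊤)
    (h : ∀ s ∈ T, σ s p - p ∈ hilbertIdeal σ) : p ∈ hilbertIdeal σ := by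
  have key : ∀ g : G, σ g p - p ∈ hilbertIdeal σ := fun g => by
    have hg : g ∈ Subgroup.closure T := hT ▸ Subgroup.mem_top g
    induction hg using Subgroup.closure_induction with
    | mem s hs => exact h s hs
    | one => simp
    | mul a b _ _ ha hb =>
      have : σ (a * b) p - p = σ a (σ b p - p) + (σ a p - p) := by
        rw [map_mul, AlgHom.mul_apply, map_sub]; ring
      rw [this]
      exact add_mem (map_mem_hilbertIdeal a hb) ha
    | inv a _ ha =>
      have : σ a⁻¹ p - p = -σ a⁻¹ (σ a p - p) := by
        rw [map_sub, ← AlgHom.mul_apply, ← map_mul]; simp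
      rw [this]
      exact neg_mem (map_mem_hilbertIdeal _ ha)
  have h1 : ∑ g, σ g p ∈ hilbertIdeal σ := by
    refine Ideal.subset_span ⟨IsInvariantUnder.sum_orbit σ p, ?_⟩
    rw [map_sum]
    refine Finset.sum_eq_zero fun g _ => ?_
    exact (hσ.homogeneous g p _ hp).coeff_eq_zero (by simp)
  have h2 : ∑ g, (σ g p - p) ∈ hilbertIdeal σ := sum_mem fun g _ => key g
  apply mem_hilbertIdeal_of_card_mul_mem
  have : C (Fintype.card G : ℂ) * p = ∑ g, σ g p - ∑ g, (σ g p - p) := by simp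
  rw [this]
  exact sub_mem h1 h2

/-- Chevalley's lemma: if `u` is an invariant outside an ideal `J` of the ring of invariants, a
homogeneous `p` with `u * p` in the extension of `J` lies in the Hilbert ideal. -/
lemma mem_hilbertIdeal_of_mul_mem_span (hσ : IsReflectionAction σ) {J : Set S}
    (hJinv : ∀ j ∈ J, IsInvariantUnder σ j) (hJ0 : 0 ∈ J)
    (hJadd : ∀ a ∈ J, ∀ b ∈ J, a + b ∈ J)
    (hJmul : ∀ r, IsInvariantUnder σ r → ∀ j ∈ J, r * j ∈ J)
    {u : S} (hu : IsInvariantUnder σ u) (huJ : u ∉ J) (d : ℕ) :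
    ∀ p : S, p.IsHomogeneous d → u * p ∈ Ideal.span J → p ∈ hilbertIdeal σ := by
  induction d with
  | zero =>
    intro p hp hup
    have avg : ∀ x ∈ Ideal.span J, ∀ a, ∑ g, σ g (a * x) ∈ J := fun x hx => by
      induction hx using Submodule.span_induction with
      | mem x hx =>
        intro a
        have : ∑ g, σ g (a * x) = (∑ g, σ g a) * x := by
          rw [Finset.sum_mul]
          exact Finset.sum_congr rfl fun g _ => by rw [map_mul, hJinv x hx g]
        rw [this]
        exact hJmul _ (IsInvariantUnder.sum_orbit σ a) x hx
      | zero => intro a; simpa using hJ0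
      | add x y _ _ hx hy =>
        intro a
        simp_rw [mul_add, map_add, Finset.sum_add_distrib]
        exact hJadd _ (hx a) _ (hy a)
      | smul b x _ hx =>
        intro a
        simpa [mul_assoc] using hx (a * b)
    obtain ⟨c, rfl⟩ : ∃ c, p = C c :=
      ⟨_, totalDegree_eq_zero_iff_eq_C.1 ((totalDegree_zero_iff_isHomogeneous _).2 hp)⟩
    by_cases hc : c = 0
    · simp [hc]
    refine absurd ?_ huJ
    have h1 := avg _ hup 1
    have h2 : ∑ g, σ g (1 * (u * C c)) = C (Fintype.card G * c) * u := by
      have : ∀ g, σ g (1 * (u * C c)) = u * C c := fun g => by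
        rw [one_mul]; exact (hu.mul (IsInvariantUnder.C c)) g
      simp_rw [this]; simp; ring
    rw [h2] at h1
    have h3 := hJmul _ (IsInvariantUnder.C (Fintype.card G * c : ℂ)⁻¹) _ h1
    rwa [← mul_assoc, ← C_mul, inv_mul_cancel₀ (by simp [hc]), C_1, one_mul] at h3
  | succ d ih =>
    intro p hp hup
    obtain ⟨T, hT, hTs⟩ := hσ.generated
    refine mem_hilbertIdeal_of_forall_sub_mem hσ hp hT fun s hs => ?_
    obtain ⟨L, hL, hL0, hdiv⟩ := hTs s hs
    have hspan : ∀ x ∈ Ideal.span J, ∃ y ∈ Ideal.span J, σ s x - x = L * y := fun x hx => by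
      induction hx using Submodule.span_induction with
      | mem x hx => exact ⟨0, zero_mem _, by rw [hJinv x hx s]; simp⟩
      | zero => exact ⟨0, zero_mem _, by simp⟩
      | add x y _ _ hx hy =>
        obtain ⟨x', hx', hx⟩ := hx
        obtain ⟨y', hy', hy⟩ := hy
        exact ⟨x' + y', add_mem hx' hy', by rw [map_add, mul_add, ← hx, ← hy]; ring⟩
      | smul a x hxJ hx =>
        obtain ⟨x', hx', hx⟩ := hx
        obtain ⟨a', ha⟩ := hdiv a
        refine ⟨σ s a * x' + a' * x,
          add_mem (Ideal.mul_mem_left _ _ hx') (Ideal.mul_mem_left _ _ hxJ), ?_⟩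
        rw [smul_eq_mul, map_mul]
        linear_combination σ s a * hx + x * ha
    obtain ⟨q₀, hq₀⟩ := hdiv p
    have hq : σ s p - p = L * homogeneousComponent d q₀ := by
      have h1 := homogeneousComponent_mul_of_isHomogeneous q₀ L (d := d + 1) hL
      rw [mul_comm, ← hq₀, homogeneousComponent_eq_self ((hσ.homogeneous s p _ hp).sub hp)] at h1
      simpa [mul_comm] using h1
    obtain ⟨y, hy, hyL⟩ := hspan _ hup
    have : y = u * homogeneousComponent d q₀ := by
      apply mul_left_cancel₀ hL0
      rw [← hyL, map_mul, hu s]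
      linear_combination u * hq
    rw [hq]
    exact Ideal.mul_mem_left _ _
      (ih _ (homogeneousComponent_isHomogeneous d q₀) (this ▸ hy))

section Independence

variable {ι : Type*} [Fintype ι] {p : ι → MvPolynomial (Fin n) ℂ} {dg : ι → ℕ}

lemma eq_zero_of_sum_mul_eq_zero_of_isHomogeneous (hσ : IsReflectionAction σ)
    (hp : ∀ i, (p i).IsHomogeneous (dg i))
    (hI : ∀ c : ι → ℂ, ∑ i, C (c i) * p i ∈ hilbertIdeal σ → c = 0) {d : ℕ} {g : ι → S}
    (hginv : ∀ i, IsInvariantUnder σ (g i))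
    (hg : ∀ i, g i = 0 ∨ dg i ≤ d ∧ (g i).IsHomogeneous (d - dg i))
    (hrel : ∑ i, g i * p i = 0) : ∀ i, g i = 0 := by
  classical
  by_contra! hne
  obtain ⟨i₁, hi₁, hmin⟩ := Finset.exists_min_image (Finset.univ.filter fun i => g i ≠ 0)
    (fun i => d - dg i) (by simpa [Finset.filter_nonempty_iff] using hne)
  simp only [Finset.mem_filter, Finset.mem_univ, true_and] at hi₁ hmin
  obtain ⟨m, hm⟩ := MvPolynomial.ne_zero_iff.1 hi₁
  have hdeg : ∀ i b, coeff b (g i) ≠ 0 → dg i ≤ d ∧ b.degree = d - dg i := fun i b hb => by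
    rcases hg i with h | ⟨h, h'⟩
    · simp [h] at hb
    · exact ⟨h, by by_contra hbd; exact hb (h'.coeff_eq_zero hbd)⟩
  let J : Set S := {r | IsInvariantUnder σ r ∧ ∀ b ≤ m, coeff b r = 0}
  let c : ι → ℂ := fun i => coeff m (g i) / coeff m (g i₁)
  have hJ : ∀ i, g i - C (c i) * g i₁ ∈ J := fun i => by
    refine ⟨(hginv i).sub ((IsInvariantUnder.C _).mul (hginv i₁)), fun b hb => ?_⟩
    rw [coeff_sub, coeff_C_mul]
    rcases hb.eq_or_lt with rfl | hlt
    · simp [c, hm]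
    have hblt : b.degree < m.degree := by
      obtain ⟨b', rfl⟩ := exists_add_of_le hb
      have : b' ≠ 0 := by rintro rfl; simp at hlt
      have := (Finsupp.degree_eq_zero_iff b').not.2 this
      simp only [map_add]
      omega
    have hi : ∀ j, coeff b (g j) = 0 := fun j => by
      by_contra hj
      have h1 := hdeg j b hj
      have h2 := hdeg i₁ m hm
      have h3 := hmin j (fun h => hj (by simp [h]))
      omega
    simp [hi]
  have hmem : ∑ i, C (c i) * p i ∈ hilbertIdeal σ := by
    refine mem_hilbertIdeal_of_mul_mem_span hσ (J := J) (fun j hj => hj.1) ⟨?_, by simp⟩ ?_ ?_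
      (hginv i₁) (fun h => hm (h.2 m le_rfl)) (dg i₁) _ ?_ ?_
    · exact IsInvariantUnder.zero
    · exact fun a ha b hb => ⟨ha.1.add hb.1, fun e he => by simp [ha.2 e he, hb.2 e he]⟩
    · refine fun r hr j hj => ⟨hr.mul hj.1, fun b hb => ?_⟩
      rw [coeff_mul]
      refine Finset.sum_eq_zero fun x hx => ?_
      rw [hj.2 x.2 ((Finset.HasAntidiagonal.mem_antidiagonal.1 hx ▸ le_add_self).trans hb),
        mul_zero]
    · refine IsHomogeneous.sum _ _ _ fun i _ => ?_
      by_cases hc : coeff m (g i) = 0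
      · simp [c, hc, isHomogeneous_zero]
      · have h1 := hdeg i m hc
        have h2 := hdeg i₁ m hm
        have : dg i₁ = dg i := by omega
        rw [this]
        exact (hp i).C_mul _
    · have : g i₁ * ∑ i, C (c i) * p i = -∑ i, p i * (g i - C (c i) * g i₁) := by
        have h : ∑ i, p i * (g i - C (c i) * g i₁) =
            ∑ i, g i * p i - g i₁ * ∑ i, C (c i) * p i := by
          rw [Finset.mul_sum, ← Finset.sum_sub_distrib]
          exact Finset.sum_congr rfl fun i _ => by ring
        rw [h, hrel]; ring
      rw [this]
      exact neg_mem (sum_mem fun i _ => Ideal.mul_mem_left _ _ (Ideal.subset_span (hJ i)))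
  have := congrFun (hI c hmem) i₁
  simp [c, hm] at this

lemma eq_zero_of_sum_mul_eq_zero (hσ : IsReflectionAction σ)
    (hp : ∀ i, (p i).IsHomogeneous (dg i))
    (hI : ∀ c : ι → ℂ, ∑ i, C (c i) * p i ∈ hilbertIdeal σ → c = 0) {g : ι → S}
    (hginv : ∀ i, IsInvariantUnder σ (g i)) (hrel : ∑ i, g i * p i = 0) (i : ι) : g i = 0 := by
  rw [← sum_homogeneousComponent (g i)]
  refine Finset.sum_eq_zero fun k _ => ?_
  have := eq_zero_of_sum_mul_eq_zero_of_isHomogeneous hσ hp hI (d := k + dg i)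
    (g := fun j => if dg j ≤ k + dg i then homogeneousComponent (k + dg i - dg j) (g j) else 0)
    (fun j => ?_) (fun j => ?_) ?_ i
  · simpa using this
  · split_ifs
    · exact (hginv j).homogeneousComponent hσ _
    · exact IsInvariantUnder.zero
  · by_cases h : dg j ≤ k + dg i
    · simp [h, homogeneousComponent_isHomogeneous]
    · simp [h]
  · have h := congrArg (homogeneousComponent (k + dg i)) hrel
    rw [map_zero, map_sum] at h
    rw [← h]
    refine Finset.sum_congr rfl fun j _ => ?_
    rw [homogeneousComponent_mul_of_isHomogeneous _ _ (hp j)]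
    split_ifs <;> simp [h]

/-- The orbit vectors of an invariant-linearly independent family are independent. -/
lemma linearIndependent_orbit (hinj : Function.Injective σ)
    (hp : ∀ g : ι → S, (∀ i, IsInvariantUnder σ (g i)) → ∑ i, g i * p i = 0 → ∀ i, g i = 0) :
    LinearIndependent S fun (i : ι) (g : G) => σ g (p i) := by
  rw [Fintype.linearIndependent_iff]
  intro c hc i
  have hc' : ∀ g, ∑ i, c i * σ g (p i) = 0 := fun g => by simpa using congrFun hc g
  have htr : ∀ a, ∑ h, σ h (c i) * σ h a = 0 := fun a => by
    have := hp (fun i => ∑ h, σ h (c i * a)) (fun i => IsInvariantUnder.sum_orbit σ _) ?_ i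
    · simpa using this
    · simp_rw [Finset.sum_mul]
      rw [Finset.sum_comm]
      refine Finset.sum_eq_zero fun h _ => ?_
      have h1 := congrArg (fun x => σ h a * σ h x) (hc' h⁻¹)
      simp only [map_sum, map_mul, ← AlgHom.mul_apply, map_zero, mul_zero] at h1
      rw [← h1, Finset.mul_sum]
      refine Finset.sum_congr rfl fun j _ => ?_
      rw [map_mul, ← map_mul σ]
      simp; ring
  have hD : LinearIndependent S fun (g : G) (a : S) => σ g a :=
    (linearIndependent_monoidHom S S).comp (fun g => ((σ g : S →ₐ[ℂ] S) : S →* S))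
      fun a b hab => hinj (AlgHom.ext fun x => DFunLike.congr_fun hab x)
  have := Fintype.linearIndependent_iff.1 hD (fun h => σ h (c i))
    (funext fun a => by simpa using htr a) 1
  simpa using this

lemma linearIndependent_orbit' (hinj : Function.Injective σ)
    (hp : ∀ x : S, ∃ F : ι → S, (∀ i, IsInvariantUnder σ (F i)) ∧ x = ∑ i, F i * p i) :
    LinearIndependent S fun (g : G) (i : ι) => σ g (p i) := by
  rw [Fintype.linearIndependent_iff]
  intro c hc
  have hc' : ∀ i, ∑ g, c g * σ g (p i) = 0 := fun i => by simpa using congrFun hc i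
  have hD : LinearIndependent S fun (g : G) (a : S) => σ g a :=
    (linearIndependent_monoidHom S S).comp (fun g => ((σ g : S →ₐ[ℂ] S) : S →* S))
      fun a b hab => hinj (AlgHom.ext fun x => DFunLike.congr_fun hab x)
  refine Fintype.linearIndependent_iff.1 hD c (funext fun a => ?_)
  obtain ⟨F, hF, rfl⟩ := hp a
  simp only [Finset.sum_apply, Pi.smul_apply, smul_eq_mul, map_sum, map_mul, Finset.mul_sum,
    Pi.zero_apply]
  rw [Finset.sum_comm]
  refine Finset.sum_eq_zero fun i _ => ?_
  have := congrArg (F i * ·) (hc' i)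
  simp only [Finset.mul_sum, mul_zero] at this
  rw [← this]
  exact Finset.sum_congr rfl fun g _ => by rw [hF i g]; ring

omit [Fintype G] in
/-- Graded Nakayama: a family spanning modulo the Hilbert ideal spans over the invariants. -/
lemma exists_eq_sum_mul (hσ : IsReflectionAction σ)
    (hp : ∀ i, (p i).IsHomogeneous (dg i))
    (hI : ∀ x, ∃ c : ι → ℂ, x - ∑ i, C (c i) * p i ∈ hilbertIdeal σ) (x : S) :
    ∃ F : ι → S, (∀ i, IsInvariantUnder σ (F i)) ∧ x = ∑ i, F i * p i := by
  set N : S → Prop := fun x => ∃ F : ι → S, (∀ i, IsInvariantUnder σ (F i)) ∧ x = ∑ i, F i * p i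
    with hN
  have h0 : N 0 := ⟨0, fun i => IsInvariantUnder.zero, by simp⟩
  have hadd : ∀ a b, N a → N b → N (a + b) := by
    rintro _ _ ⟨F, hF, rfl⟩ ⟨F', hF', rfl⟩
    exact ⟨fun i => F i + F' i, fun i => (hF i).add (hF' i), by
      simp [add_mul, Finset.sum_add_distrib]⟩
  have hmul : ∀ r a, IsInvariantUnder σ r → N a → N (r * a) := by
    rintro r _ hr ⟨F, hF, rfl⟩
    exact ⟨fun i => r * F i, fun i => hr.mul (hF i), by simp [Finset.mul_sum, mul_assoc]⟩
  have hsum : ∀ {κ : Type} (s : Finset κ) (f : κ → S), (∀ k ∈ s, N (f k)) → N (∑ k ∈ s, f k) :=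
    fun s f h => Finset.sum_induction f N hadd h0 h
  have hom : ∀ d x, x.IsHomogeneous d → N x := fun d => by
    induction d using Nat.strong_induction_on with
    | _ d ih =>
      have hcomp : ∀ x ∈ hilbertIdeal σ, ∀ a, N (homogeneousComponent d (a * x)) := fun x hx => by
        induction hx using Submodule.span_induction with
        | mem r hr =>
          intro a
          rw [← sum_homogeneousComponent r, Finset.mul_sum, map_sum]
          refine hsum _ _ fun k _ => ?_
          rw [homogeneousComponent_mul_of_isHomogeneous _ _
            (homogeneousComponent_isHomogeneous k r)]
          split_ifs with hkd
          · rcases Nat.eq_zero_or_pos k with rfl | hk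
            · have : coeff 0 r = 0 := hr.2
              simpa [homogeneousComponent_zero, this] using h0
            · rw [mul_comm]
              exact hmul _ _ (hr.1.homogeneousComponent hσ k)
                (ih (d - k) (by omega) _ (homogeneousComponent_isHomogeneous _ _))
          · exact h0
        | zero => intro a; simpa using h0
        | add x y _ _ hx hy => intro a; rw [mul_add, map_add]; exact hadd _ _ (hx a) (hy a)
        | smul b x _ hx => intro a; rw [smul_eq_mul, ← mul_assoc]; exact hx _
      intro x hx
      obtain ⟨c, hc⟩ := hI x
      have h1 : N (homogeneousComponent d (∑ i, C (c i) * p i)) := by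
        refine ⟨fun i => if dg i ≤ d then homogeneousComponent (d - dg i) (C (c i)) else 0,
          fun i => ?_, ?_⟩
        · beta_reduce
          split_ifs
          · exact (IsInvariantUnder.C _).homogeneousComponent hσ _
          · exact IsInvariantUnder.zero
        · rw [map_sum]
          refine Finset.sum_congr rfl fun i _ => ?_
          rw [homogeneousComponent_mul_of_isHomogeneous _ _ (hp i), ite_mul, zero_mul]
      have h2 := hadd _ _ (hcomp _ hc 1) h1
      rwa [one_mul, ← map_add, sub_add_cancel, homogeneousComponent_eq_self hx] at h2
  rw [← sum_homogeneousComponent x]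
  exact hsum _ _ fun k _ => hom k _ (homogeneousComponent_isHomogeneous k x)

end Independence

omit [Fintype G] in
/-- Homogeneous polynomials contain a family which is a basis modulo the Hilbert ideal. -/
lemma exists_homogeneous_basis_mod
    (σ : G →* (MvPolynomial (Fin n) ℂ →ₐ[ℂ] MvPolynomial (Fin n) ℂ)) :
    ∃ (ι : Type) (p : ι → S) (dg : ι → ℕ), (∀ i, (p i).IsHomogeneous (dg i)) ∧
      LinearIndependent ℂ (fun i => Ideal.Quotient.mk (hilbertIdeal σ) (p i)) ∧
      Submodule.span ℂ (Set.range fun i => Ideal.Quotient.mk (hilbertIdeal σ) (p i)) = ⊤ := by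
  let t : Set (S ⧸ hilbertIdeal σ) :=
    {y | ∃ (x : S) (d : ℕ), x.IsHomogeneous d ∧ Ideal.Quotient.mk _ x = y}
  obtain ⟨b, hbt, hspan, hli⟩ := exists_linearIndependent ℂ t
  choose p dg hp hpb using fun y : b => hbt y.2
  refine ⟨b, p, dg, hp, by simpa [hpb] using hli, ?_⟩
  simp_rw [hpb, Subtype.range_coe, hspan, eq_top_iff]
  intro y _
  obtain ⟨x, rfl⟩ := Ideal.Quotient.mk_surjective y
  rw [← sum_homogeneousComponent x, map_sum]
  exact sum_mem fun k _ => Submodule.subset_span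
    ⟨_, k, homogeneousComponent_isHomogeneous k x, rfl⟩

/-- Chevalley's theorem, together with the Cramer data inverting the orbit matrix. -/
theorem IsReflectionAction.exists_homogeneous_basis (hσ : IsReflectionAction σ)
    (hinj : Function.Injective σ) :
    ∃ (p : Fin (Fintype.card G) → S) (D : S) (N : Fin (Fintype.card G) → G → S),
      (∀ i, (p i).IsHomogeneous (p i).totalDegree) ∧ D ≠ 0 ∧
      (∀ i j, ∑ g, N i g * σ g (p j) = if i = j then D else 0) ∧
      ∀ x : S, ∃ F : Fin (Fintype.card G) → S,
        (∀ i, IsInvariantUnder σ (F i)) ∧ x = ∑ i, F i * p i := by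
  classical
  obtain ⟨ι, p, dg, hp, hli, hspan⟩ := exists_homogeneous_basis_mod σ
  have hfam : ∀ {κ : Type} [Fintype κ] (e : κ → ι), Function.Injective e →
      LinearIndependent S fun (i : κ) (g : G) => σ g (p (e i)) := fun {κ} _ e he => by
    refine linearIndependent_orbit hinj fun g hg hrel =>
      eq_zero_of_sum_mul_eq_zero hσ (fun i => hp (e i)) (fun c hc => ?_) hg hrel
    refine funext (Fintype.linearIndependent_iff.1 (hli.comp e he) c ?_)
    rw [← Ideal.Quotient.eq_zero_iff_mem, map_sum] at hc
    rw [← hc]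
    exact Finset.sum_congr rfl fun i _ => by rw [← smul_eq_C_mul]; rfl
  have hfin : Finite ι := by
    by_contra hinf
    rw [not_finite_iff_infinite] at hinf
    have := (hfam _ (Infinite.natEmbedding ι |>.injective.comp
      (Fin.val_injective (n := Fintype.card G + 1)))).fintype_card_le_finrank
    simp at this
  have := Fintype.ofFinite ι
  have hgen : ∀ x, ∃ c : ι → ℂ, x - ∑ i, C (c i) * p i ∈ hilbertIdeal σ := fun x => by
    have hx : Ideal.Quotient.mk (hilbertIdeal σ) x ∈ Submodule.span ℂ
      (Set.range fun i => Ideal.Quotient.mk (hilbertIdeal σ) (p i)) := hspan ▸ Submodule.mem_top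
    obtain ⟨c, hc⟩ := (Submodule.mem_span_range_iff_exists_fun ℂ).1 hx
    refine ⟨c, ?_⟩
    rw [← Ideal.Quotient.eq_zero_iff_mem, map_sub, ← hc, map_sum, sub_eq_zero]
    exact Finset.sum_congr rfl fun i _ => by rw [← smul_eq_C_mul]; rfl
  have hdec := exists_eq_sum_mul hσ hp hgen
  have hrows := linearIndependent_orbit' hinj hdec
  have hcard : Fintype.card ι = Fintype.card G := by
    refine le_antisymm ?_ ?_
    · simpa using (hfam id Function.injective_id).fintype_card_le_finrank
    · simpa using hrows.fintype_card_le_finrank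
  let e : Fin (Fintype.card G) ≃ ι := (Fintype.equivFinOfCardEq hcard).symm
  let e' : Fin (Fintype.card G) ≃ G := (Fintype.equivFin G).symm
  let A : Matrix (Fin (Fintype.card G)) (Fin (Fintype.card G)) S :=
    .of fun a i => σ (e' a) (p (e i))
  refine ⟨p ∘ e, A.det, fun i g => A.adjugate i (e'.symm g), fun i => ?_, ?_, fun i j => ?_,
    fun x => ?_⟩
  · by_cases h : p (e i) = 0
    · simp [h, isHomogeneous_zero]
    · simpa [(hp (e i)).totalDegree h] using hp (e i)
  · intro h
    obtain ⟨v, hv, hv0⟩ := Matrix.exists_mulVec_eq_zero_iff.2 h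
    refine hv (funext fun i => ?_)
    refine Fintype.linearIndependent_iff.1 (hfam e e.injective) v (funext fun g => ?_) i
    have := congrFun hv0 (e'.symm g)
    simpa [Matrix.mulVec, dotProduct, A, mul_comm] using this
  · have := congrFun (congrFun A.adjugate_mul i) j
    rw [Matrix.mul_apply] at this
    rw [← Equiv.sum_comp e']
    simpa [A, Matrix.one_apply] using this
  · obtain ⟨F, hF, hx⟩ := hdec x
    exact ⟨F ∘ e, fun i => hF _, by rw [hx, ← Equiv.sum_comp e]; rfl⟩

end InvariantTheory
section LinearSubstitution

variable {n : ℕ}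

/-- The algebra endomorphism `p ↦ p ∘ T` of the polynomial ring. -/
def substLinear (T : (Fin n → ℂ) →ₗ[ℂ] (Fin n → ℂ)) :
    MvPolynomial (Fin n) ℂ →ₐ[ℂ] MvPolynomial (Fin n) ℂ :=
  aeval fun i => ∑ j, C (T (Pi.single j 1) i) * X j

lemma eval_substLinear (T : (Fin n → ℂ) →ₗ[ℂ] (Fin n → ℂ)) (p : MvPolynomial (Fin n) ℂ)
    (l : Fin n → ℂ) : eval l (substLinear T p) = eval (T l) p := by
  induction p using MvPolynomial.induction_on with
  | C a => simp [substLinear, algebraMap_eq]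
  | add p q hp hq => simp [hp, hq]
  | mul_X p i hp =>
    have h : T l i = ∑ j, T (Pi.single j 1) i * l j := by
      conv_lhs => rw [← Finset.univ_sum_single l, map_sum, Finset.sum_apply]
      refine Finset.sum_congr rfl fun j _ => ?_
      rw [← mul_one (l j), ← smul_eq_mul, Pi.single_smul, map_smul]
      simp [mul_comm]
    rw [map_mul, map_mul, map_mul, hp, eval_X, h]
    simp [substLinear]

lemma isHomogeneous_substLinear (T : (Fin n → ℂ) →ₗ[ℂ] (Fin n → ℂ)) {p : MvPolynomial (Fin n) ℂ}
    {d : ℕ} (hp : p.IsHomogeneous d) : (substLinear T p).IsHomogeneous d := by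
  have := hp.aeval (fun i => ∑ j, C (T (Pi.single j 1) i) * X j) (n := 1)
    fun i => IsHomogeneous.sum _ _ _ fun j _ => isHomogeneous_C_mul_X _ _
  rwa [one_mul] at this

variable {G : Type} [Group G]

/-- The action `(g · p)(l) = p (ρ g⁻¹ l)` on polynomials. -/
def polynomialAction (ρ : G →* ((Fin n → ℂ) ≃ₗ[ℂ] (Fin n → ℂ))) :
    G →* (MvPolynomial (Fin n) ℂ →ₐ[ℂ] MvPolynomial (Fin n) ℂ) where
  toFun g := substLinear (ρ g⁻¹).toLinearMap
  map_one' := AlgHom.ext fun p => MvPolynomial.funext fun l => by simp [eval_substLinear]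
  map_mul' g h := AlgHom.ext fun p => MvPolynomial.funext fun l => by simp [eval_substLinear]

lemma eval_polynomialAction (ρ : G →* ((Fin n → ℂ) ≃ₗ[ℂ] (Fin n → ℂ))) (g : G)
    (p : MvPolynomial (Fin n) ℂ) (l : Fin n → ℂ) :
    eval l (polynomialAction ρ g p) = eval (ρ g⁻¹ l) p :=
  eval_substLinear _ p l

lemma polynomialAction_injective {ρ : G →* ((Fin n → ℂ) ≃ₗ[ℂ] (Fin n → ℂ))}
    (hρ : Function.Injective ρ) : Function.Injective (polynomialAction ρ) := fun g h hgh => by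
  refine inv_injective (hρ (LinearEquiv.ext fun l => funext fun i => ?_))
  simpa [eval_polynomialAction] using congrArg (fun σ => eval l (σ (X i))) hgh

lemma IsReflection.exists_linear_form {T : (Fin n → ℂ) →ₗ[ℂ] (Fin n → ℂ)} (hT : IsReflection T) :
    ∃ L : MvPolynomial (Fin n) ℂ, L.IsHomogeneous 1 ∧ L ≠ 0 ∧
      ∀ p, ∃ q, substLinear T p - p = L * q := by
  obtain ⟨-, hne, hrank⟩ := hT
  obtain ⟨v, hv0, hv⟩ := finrank_eq_one_iff'.1 hrank
  have hv0' : (v : Fin n → ℂ) ≠ 0 := by simpa using hv0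
  obtain ⟨i₀, hi₀⟩ := Function.ne_iff.1 hv0'
  have hT : ∀ l i, T l i - l i =
      (v : Fin n → ℂ) i * (((v : Fin n → ℂ) i₀)⁻¹ * (T l i₀ - l i₀)) := by
    intro l i
    obtain ⟨c, hc⟩ := hv ⟨T l - l, l, rfl⟩
    have hc' : ∀ i, c * (v : Fin n → ℂ) i = T l i - l i := fun i => by
      simpa using congrFun (congrArg Subtype.val hc) i
    rw [← hc', ← hc' i₀, mul_comm c _, mul_comm c _, inv_mul_cancel_left₀ hi₀]
  let L : MvPolynomial (Fin n) ℂ := C ((v : Fin n → ℂ) i₀)⁻¹ * (substLinear T (X i₀) - X i₀)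
  have hX : ∀ i, substLinear T (X i) - X i = L * C ((v : Fin n → ℂ) i) := fun i =>
    MvPolynomial.funext fun l => by
      simp only [L, map_sub, map_mul, eval_substLinear, eval_X, eval_C]
      rw [hT l i]; ring
  refine ⟨L, ?_, fun hL => hne (LinearMap.ext fun l => funext fun i => ?_), fun p => ?_⟩
  · exact ((isHomogeneous_substLinear T (isHomogeneous_X ℂ i₀)).sub (isHomogeneous_X ℂ i₀)).C_mul _
  · have := congrArg (eval l) (hX i)
    simpa [hL, eval_substLinear, sub_eq_zero] using this
  · induction p using MvPolynomial.induction_on with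
    | C a => exact ⟨0, by simp [substLinear, algebraMap_eq]⟩
    | add p q hp hq =>
      obtain ⟨p', hp⟩ := hp
      obtain ⟨q', hq⟩ := hq
      exact ⟨p' + q', by rw [map_add, mul_add, ← hp, ← hq]; ring⟩
    | mul_X p i hp =>
      obtain ⟨p', hp⟩ := hp
      refine ⟨p' * substLinear T (X i) + p * C ((v : Fin n → ℂ) i), ?_⟩
      rw [map_mul]
      linear_combination substLinear T (X i) * hp + p * hX i

lemma isReflectionAction_polynomialAction {ρ : G →* ((Fin n → ℂ) ≃ₗ[ℂ] (Fin n → ℂ))}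
    (hgen : ∃ T : Set G, Subgroup.closure T = ⊤ ∧ ∀ s ∈ T, IsReflection (ρ s).toLinearMap) :
    IsReflectionAction (polynomialAction ρ) where
  homogeneous _ _ _ hp := isHomogeneous_substLinear _ hp
  generated := by
    obtain ⟨T, hT, hs⟩ := hgen
    refine ⟨T, hT, fun s hsT => ?_⟩
    have hinv : ρ s⁻¹ = ρ s := LinearEquiv.ext fun l => by
      have := LinearMap.congr_fun (hs s hsT).1 (ρ s⁻¹ l)
      simpa using this.symm
    obtain ⟨L, hL, hL0, hdiv⟩ := (hs s hsT).exists_linear_form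
    refine ⟨L, hL, hL0, fun p => ?_⟩
    change ∃ q, substLinear (ρ s⁻¹).toLinearMap p - p = L * q
    rw [hinv]
    exact hdiv p

end LinearSubstitution
section EntireFunctions

open Filter Topology Metric

variable {n : ℕ}

lemma differentiable_eval (p : MvPolynomial (Fin n) ℂ) :
    Differentiable ℂ fun l : Fin n → ℂ => eval l p := by
  induction p using MvPolynomial.induction_on with
  | C a => simp
  | add p q hp hq => simp only [map_add]; exact hp.add hq
  | mul_X p i hp =>
    simp only [map_mul, eval_X]
    fun_prop

/-- The restriction of a polynomial to the affine line through `l` in the direction `v`. -/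
def linePolynomial (l v : Fin n → ℂ) (p : MvPolynomial (Fin n) ℂ) : Polynomial ℂ :=
  aeval (fun i => Polynomial.C (l i) + Polynomial.C (v i) * Polynomial.X) p

lemma eval_linePolynomial (l v : Fin n → ℂ) (p : MvPolynomial (Fin n) ℂ) (t : ℂ) :
    (linePolynomial l v p).eval t = eval (l + t • v) p := by
  induction p using MvPolynomial.induction_on with
  | C a => simp [linePolynomial]
  | add p q hp hq => simp_all [linePolynomial]
  | mul_X p i hp =>
    rw [linePolynomial] at hp ⊢
    simp only [map_mul, aeval_X, Polynomial.eval_mul, hp, eval_X]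
    simp only [Polynomial.eval_add, Polynomial.eval_mul, Polynomial.eval_C, Polynomial.eval_X,
      Pi.add_apply, Pi.smul_apply, smul_eq_mul, mul_comm t]

lemma linePolynomial_monomial (l v : Fin n → ℂ) (e : Fin n →₀ ℕ) (c : ℂ) :
    (linePolynomial l v (monomial e c)).natDegree ≤ e.degree ∧
      (linePolynomial l v (monomial e c)).coeff e.degree = eval v (monomial e c) := by
  have hlin : ∀ i, (Polynomial.C (l i) + Polynomial.C (v i) * Polynomial.X).natDegree ≤ 1 :=
    fun i => by compute_degree
  have hpow : ∀ i k, ((Polynomial.C (l i) + Polynomial.C (v i) * Polynomial.X) ^ k).natDegree ≤ k ∧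
      ((Polynomial.C (l i) + Polynomial.C (v i) * Polynomial.X) ^ k).coeff k = v i ^ k := by
    intro i k
    refine ⟨by simpa using Polynomial.natDegree_pow_le_of_le k (hlin i), ?_⟩
    simpa using Polynomial.coeff_pow_of_natDegree_le (m := k) (hlin i)
  have hprod : ∀ s : Finset (Fin n),
      (∏ i ∈ s, (Polynomial.C (l i) + Polynomial.C (v i) * Polynomial.X) ^ e i).natDegree ≤
        ∑ i ∈ s, e i ∧
      (∏ i ∈ s, (Polynomial.C (l i) + Polynomial.C (v i) * Polynomial.X) ^ e i).coeff
        (∑ i ∈ s, e i) = ∏ i ∈ s, v i ^ e i := fun s => by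
    induction s using Finset.cons_induction with
    | empty => simp
    | cons i s hi ih =>
      simp only [Finset.prod_cons, Finset.sum_cons]
      refine ⟨Polynomial.natDegree_mul_le_of_le (hpow i _).1 ih.1, ?_⟩
      rw [Polynomial.coeff_mul_add_eq_of_natDegree_le (hpow i _).1 ih.1, (hpow i _).2, ih.2]
  have hdeg : e.degree = ∑ i, e i := Finsupp.degree_eq_sum e
  have hline : linePolynomial l v (monomial e c) = Polynomial.C c *
      ∏ i, (Polynomial.C (l i) + Polynomial.C (v i) * Polynomial.X) ^ e i := by
    rw [linePolynomial, aeval_monomial, Finsupp.prod_fintype _ _ (by simp)]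
    rfl
  rw [hline, hdeg, Polynomial.coeff_C_mul, (hprod _).2, eval_monomial,
    Finsupp.prod_fintype _ _ (by simp)]
  exact ⟨(Polynomial.natDegree_C_mul_le _ _).trans (hprod _).1, rfl⟩

lemma natDegree_linePolynomial_le (l v : Fin n → ℂ) (p : MvPolynomial (Fin n) ℂ) :
    (linePolynomial l v p).natDegree ≤ p.totalDegree := by
  conv_lhs => rw [p.as_sum, linePolynomial, map_sum]
  refine Polynomial.natDegree_sum_le_of_forall_le _ _ fun e he => ?_
  exact (linePolynomial_monomial l v e _).1.trans (le_totalDegree he)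

lemma coeff_linePolynomial (l v : Fin n → ℂ) (p : MvPolynomial (Fin n) ℂ) :
    (linePolynomial l v p).coeff p.totalDegree =
      eval v (homogeneousComponent p.totalDegree p) := by
  conv_lhs => rw [p.as_sum, linePolynomial, map_sum, Polynomial.finsetSum_coeff, ← p.as_sum]
  rw [homogeneousComponent_apply, map_sum, Finset.sum_filter]
  refine Finset.sum_congr rfl fun e he => ?_
  split_ifs with h
  · rw [← h]; exact (linePolynomial_monomial l v e _).2
  · refine Polynomial.coeff_eq_zero_of_natDegree_lt
      ((linePolynomial_monomial l v e _).1.trans_lt ?_)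
    exact lt_of_le_of_ne (le_totalDegree he) h

lemma norm_coeff_mul_le (P : Polynomial ℂ) {m : ℕ} (hm : P.natDegree ≤ m) {h : ℂ → ℂ}
    (hd : Differentiable ℂ h) {B : ℝ} (hB : ∀ z, ‖z‖ = 1 → ‖P.eval z * h z‖ ≤ B) :
    ‖P.coeff m * h 0‖ ≤ B := by
  let Q : ℂ → ℂ := fun z => ∑ k ∈ Finset.range (m + 1), (starRingEnd ℂ) (P.coeff k) * z ^ (m - k)
  have hQ0 : Q 0 = (starRingEnd ℂ) (P.coeff m) := by
    simp only [Q]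
    rw [Finset.sum_eq_single m]
    · simp
    · intro k hk hkm
      rw [zero_pow, mul_zero]
      simp at hk; omega
    · simp
  have hQ : ∀ z, ‖z‖ = 1 → ‖Q z‖ = ‖P.eval z‖ := fun z hz => by
    have hzz : z * (starRingEnd ℂ) z = 1 := by rw [Complex.mul_conj']; simp [hz]
    have : Q z = z ^ m * (starRingEnd ℂ) (P.eval z) := by
      rw [Polynomial.eval_eq_sum_range' (Nat.lt_succ_of_le hm), map_sum, Finset.mul_sum]
      refine Finset.sum_congr rfl fun k hk => ?_
      have hk' : m = m - k + k := by simp at hk; omega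
      rw [map_mul, map_pow]
      conv_rhs => rw [hk', pow_add]
      have : z ^ k * (starRingEnd ℂ) z ^ k = 1 := by rw [← mul_pow, hzz, one_pow]
      linear_combination (-(starRingEnd ℂ) (P.coeff k) * z ^ (m - k)) * this
    rw [this, norm_mul, norm_pow, hz, one_pow, one_mul, Complex.norm_conj]
  have hQd : Differentiable ℂ Q := by
    simp only [Q]
    fun_prop
  have := Complex.norm_le_of_forall_mem_frontier_norm_le (U := ball (0 : ℂ) 1) isBounded_ball
    (hQd.mul hd).diffContOnCl (C := B) (fun z hz => ?_) (z := 0)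
    (subset_closure (mem_ball_self one_pos))
  · simpa [hQ0] using this
  · rw [frontier_ball _ one_ne_zero, mem_sphere_zero_iff_norm] at hz
    rw [Pi.mul_apply, norm_mul, hQ z hz, ← norm_mul]
    exact hB z hz

/-- Division by a polynomial is bounded, uniformly in the base point. -/
lemma exists_norm_le_of_norm_mul_le {D : MvPolynomial (Fin n) ℂ} (hD : D ≠ 0) :
    ∃ K : ℝ, 0 ≤ K ∧ ∀ h : (Fin n → ℂ) → ℂ, Differentiable ℂ h → ∀ l B,
      (∀ μ, ‖μ - l‖ ≤ 1 → ‖eval μ D * h μ‖ ≤ B) → ‖h l‖ ≤ K * B := by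
  have htop : homogeneousComponent D.totalDegree D ≠ 0 := by
    obtain ⟨e, he, hmax⟩ := Finset.exists_mem_eq_sup D.support (support_nonempty.2 hD)
      fun s => s.sum fun _ k => k
    intro h
    have h1 := congrArg (coeff e) h
    have h2 : e.degree = D.totalDegree := hmax.symm
    rw [coeff_homogeneousComponent, if_pos h2] at h1
    exact mem_support_iff.1 he (by simpa using h1)
  obtain ⟨v, hv, hv0⟩ : ∃ v : Fin n → ℂ, ‖v‖ ≤ 1 ∧
      eval v (homogeneousComponent D.totalDegree D) ≠ 0 := by
    by_contra! hcon
    refine htop (funext_set (fun _ => closedBall (0 : ℂ) 1) (fun _ => ?_) fun x hx => ?_)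
    · exact infinite_of_mem_nhds (0 : ℂ) (closedBall_mem_nhds _ one_pos)
    · rw [map_zero]
      refine hcon x ((pi_norm_le_iff_of_nonneg zero_le_one).2 fun i => ?_)
      simpa using hx i (Set.mem_univ i)
  refine ⟨‖eval v (homogeneousComponent D.totalDegree D)‖⁻¹, by positivity,
    fun h hd l B hB => ?_⟩
  have := norm_coeff_mul_le (linePolynomial l v D) (natDegree_linePolynomial_le l v D)
    (h := fun t => h (l + t • v)) (by fun_prop) (B := B) fun z hz => by
      rw [eval_linePolynomial]
      refine hB _ ?_
      rw [add_sub_cancel_left, norm_smul, hz, one_mul]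
      exact hv
  rw [coeff_linePolynomial, zero_smul, add_zero, norm_mul] at this
  rwa [inv_mul_eq_div, le_div_iff₀' (norm_pos_iff.2 hv0)]

lemma norm_fderiv_le {h : (Fin n → ℂ) → ℂ} (hd : Differentiable ℂ h) {l : Fin n → ℂ} {B : ℝ}
    (hB : ∀ μ, ‖μ - l‖ ≤ 1 → ‖h μ‖ ≤ B) : ‖fderiv ℂ h l‖ ≤ B := by
  have hB0 : 0 ≤ B := (norm_nonneg _).trans (hB l (by simp))
  refine ContinuousLinearMap.opNorm_le_bound _ hB0 fun v => ?_
  rcases eq_or_ne v 0 with rfl | hv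
  · simp
  have hv' : 0 < ‖v‖ := norm_pos_iff.2 hv
  have hline : HasDerivAt (fun t : ℂ => l + t • v) v 0 := by
    simpa using ((hasDerivAt_id (0 : ℂ)).smul_const v).const_add l
  have h1 : HasDerivAt (fun t : ℂ => h (l + t • v)) (fderiv ℂ h l v) 0 :=
    HasFDerivAt.comp_hasDerivAt (0 : ℂ) (by simpa using (hd l).hasFDerivAt) hline
  have h2 := Complex.norm_deriv_le_of_forall_mem_sphere_norm_le (c := (0 : ℂ))
    (f := fun t => h (l + t • v)) (inv_pos.2 hv') (C := B)
    (Differentiable.diffContOnCl (by fun_prop)) fun z hz => by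
      refine hB _ ?_
      rw [mem_sphere_zero_iff_norm] at hz
      rw [add_sub_cancel_left, norm_smul, hz, inv_mul_cancel₀ hv'.ne']
  rwa [h1.deriv, div_inv_eq_mul] at h2

/-- Locally uniform Cauchy sequences of entire functions of several variables converge to
entire functions. -/
lemma exists_entire_tendsto {h : ℕ → (Fin n → ℂ) → ℂ} (hd : ∀ k, Differentiable ℂ (h k))
    (hc : ∀ R : ℝ, ∀ ε > 0, ∃ N, ∀ j ≥ N, ∀ k ≥ N, ∀ l : Fin n → ℂ, ‖l‖ ≤ R →
      ‖h j l - h k l‖ ≤ ε) :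
    ∃ H : (Fin n → ℂ) → ℂ, Differentiable ℂ H ∧ ∀ l, Tendsto (fun k => h k l) atTop (𝓝 (H l)) := by
  have hlim : ∀ l, ∃ y, Tendsto (fun k => h k l) atTop (𝓝 y) := fun l => by
    refine cauchySeq_tendsto_of_complete (Metric.cauchySeq_iff.2 fun ε hε => ?_)
    obtain ⟨N, hN⟩ := hc ‖l‖ (ε / 2) (by positivity)
    refine ⟨N, fun j hj k hk => ?_⟩
    rw [dist_eq_norm]
    linarith [hN j hj k hk l le_rfl]
  have hder : ∀ R : ℝ, ∀ ε > 0, ∃ N, ∀ j ≥ N, ∀ k ≥ N, ∀ l : Fin n → ℂ, ‖l‖ ≤ R →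
      ‖fderiv ℂ (h j) l - fderiv ℂ (h k) l‖ ≤ ε := fun R ε hε => by
    obtain ⟨N, hN⟩ := hc (R + 1) ε hε
    refine ⟨N, fun j hj k hk l hl => ?_⟩
    rw [← fderiv_sub (hd j l) (hd k l)]
    refine norm_fderiv_le ((hd j).sub (hd k)) fun μ hμ => hN j hj k hk μ ?_
    linarith [norm_le_norm_add_norm_sub' μ l]
  have hderlim : ∀ l, ∃ y, Tendsto (fun k => fderiv ℂ (h k) l) atTop (𝓝 y) := fun l => by
    refine cauchySeq_tendsto_of_complete (Metric.cauchySeq_iff.2 fun ε hε => ?_)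
    obtain ⟨N, hN⟩ := hder ‖l‖ (ε / 2) (by positivity)
    refine ⟨N, fun j hj k hk => ?_⟩
    rw [dist_eq_norm]
    linarith [hN j hj k hk l le_rfl]
  choose H hH using hlim
  choose H' hH' using hderlim
  refine ⟨H, fun l => ?_, hH⟩
  have hunif : TendstoUniformlyOn (fun k => fderiv ℂ (h k)) H' atTop (ball 0 (‖l‖ + 1)) := by
    refine UniformCauchySeqOn.tendstoUniformlyOn_of_tendsto ?_ fun l _ => hH' l
    refine Metric.uniformCauchySeqOn_iff.2 fun ε hε => ?_
    obtain ⟨N, hN⟩ := hder (‖l‖ + 1) (ε / 2) (by positivity)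
    refine ⟨N, fun j hj k hk x hx => ?_⟩
    rw [mem_ball_zero_iff] at hx
    rw [dist_eq_norm]
    linarith [hN j hj k hk x hx.le]
  exact (hasFDerivAt_of_tendstoUniformlyOn isOpen_ball hunif
    (fun k x _ => (hd k x).hasFDerivAt) (fun x _ => hH x) (by simp)).differentiableAt

/-- Iterated divided differences of `f` at the nodes `1, 1/2, 1/3, …`. -/
def newtonSeq (f : ℂ → ℂ) : ℕ → ℂ → ℂ
  | 0 => f
  | k + 1 => dslope (newtonSeq f k) (k + 1 : ℂ)⁻¹

lemma eq_newton_sum_add (f : ℂ → ℂ) (N : ℕ) (z : ℂ) :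
    f z = ∑ j ∈ Finset.range N, (∏ i ∈ Finset.range j, (z - (i + 1 : ℂ)⁻¹)) *
      newtonSeq f j (j + 1 : ℂ)⁻¹ +
      (∏ i ∈ Finset.range N, (z - (i + 1 : ℂ)⁻¹)) * newtonSeq f N z := by
  induction N with
  | zero => simp [newtonSeq]
  | succ N ih =>
    rw [Finset.sum_range_succ, Finset.prod_range_succ]
    have := sub_smul_dslope (newtonSeq f N) (N + 1 : ℂ)⁻¹ z
    rw [smul_eq_mul] at this
    rw [newtonSeq]
    linear_combination ih - (∏ i ∈ Finset.range N, (z - (i + 1 : ℂ)⁻¹)) * this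

lemma differentiable_newtonSeq {f : ℂ → ℂ} (hf : Differentiable ℂ f) (k : ℕ) :
    Differentiable ℂ (newtonSeq f k) := by
  induction k with
  | zero => exact hf
  | succ k ih =>
    rw [← differentiableOn_univ] at ih ⊢
    exact (Complex.differentiableOn_dslope univ_mem).2 ih

lemma norm_inv_natCast_succ_le (k : ℕ) : ‖(k + 1 : ℂ)⁻¹‖ ≤ 1 := by
  rw [norm_inv]
  refine inv_le_one_of_one_le₀ ?_
  have : ((k + 1 : ℕ) : ℂ) = (k + 1 : ℂ) := by push_cast; rfl
  rw [← this, Complex.norm_natCast]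
  simp

lemma norm_newtonSeq_le {f : ℂ → ℂ} (hf : Differentiable ℂ f) {R M : ℝ} (hR : 0 ≤ R)
    (hM : ∀ z, ‖z‖ ≤ 4 * (R + 1) + 1 → ‖f z‖ ≤ M) (k : ℕ) :
    ∀ z, ‖z‖ ≤ 4 * (R + 1) + 1 → ‖newtonSeq f k z‖ ≤ M * ((2 * (R + 1))⁻¹) ^ k := by
  induction k with
  | zero => simpa [newtonSeq] using hM
  | succ k ih =>
    intro z hz
    have hR' : (4 * (R + 1) + 1 : ℝ) ≠ 0 := by positivity
    refine Complex.norm_le_of_forall_mem_frontier_norm_le (U := ball (0 : ℂ) (4 * (R + 1) + 1))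
      isBounded_ball (differentiable_newtonSeq hf (k + 1)).diffContOnCl (fun w hw => ?_) (z := z) ?_
    · rw [frontier_ball _ hR', mem_sphere_zero_iff_norm] at hw
      have hnode := norm_inv_natCast_succ_le k
      have hdist : 4 * (R + 1) ≤ ‖w - (k + 1 : ℂ)⁻¹‖ := by
        linarith [norm_sub_norm_le w (k + 1 : ℂ)⁻¹]
      have hne : w - (k + 1 : ℂ)⁻¹ ≠ 0 := norm_pos_iff.1 (by linarith)
      have h1 := sub_smul_dslope (newtonSeq f k) (k + 1 : ℂ)⁻¹ w
      have h2 := congrArg norm h1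
      rw [norm_smul] at h2
      have h3 := norm_sub_le (newtonSeq f k w) (newtonSeq f k (k + 1 : ℂ)⁻¹)
      have h4 := ih w hw.le
      have h5 := ih (k + 1 : ℂ)⁻¹ (by linarith)
      have h6 := mul_le_mul_of_nonneg_right hdist
        (norm_nonneg (dslope (newtonSeq f k) (k + 1 : ℂ)⁻¹ w))
      have h7 : 4 * (R + 1) * ‖dslope (newtonSeq f k) (k + 1 : ℂ)⁻¹ w‖ ≤
          2 * (M * ((2 * (R + 1))⁻¹) ^ k) := by linarith
      rw [newtonSeq, pow_succ, ← mul_assoc, ← div_eq_mul_inv, le_div_iff₀ (by positivity)]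
      linarith
    · rw [closure_ball _ hR']
      simpa using hz

lemma differentiable_newtonSeq_param {E : Type*} [NormedAddCommGroup E] [NormedSpace ℂ E]
    {F : E → ℂ → ℂ} (hF : ∀ z, Differentiable ℂ fun e => F e z) (k : ℕ) :
    ∀ z, (∀ j < k, z ≠ (j + 1 : ℂ)⁻¹) → Differentiable ℂ fun e => newtonSeq (F e) k z := by
  induction k with
  | zero => exact fun z _ => hF z
  | succ k ih =>
    intro z hz
    have h1 : ∀ j < k, ((k : ℂ) + 1)⁻¹ ≠ ((j : ℂ) + 1)⁻¹ := fun j hj h => by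
      have : (k : ℂ) = j := by simpa using h
      exact hj.ne' (by exact_mod_cast this)
    simp_rw [newtonSeq, dslope_of_ne _ (hz k k.lt_succ_self), slope_def_field]
    have h2 : Differentiable ℂ fun e => newtonSeq (F e) k z - newtonSeq (F e) k ((k : ℂ) + 1)⁻¹ :=
      (ih z fun j hj => hz j (by omega)).sub (ih _ h1)
    simpa only [div_eq_mul_inv] using h2.mul_const _

/-- Entire functions of several variables are locally uniform limits of polynomials. -/
lemma exists_polynomial_approx (n : ℕ) : ∀ f : (Fin n → ℂ) → ℂ, Differentiable ℂ f →
    ∀ R : ℝ, ∀ ε > 0, ∃ P : MvPolynomial (Fin n) ℂ, ∀ z, ‖z‖ ≤ R → ‖f z - eval z P‖ ≤ ε := by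
  induction n with
  | zero =>
    intro f _ R ε hε
    exact ⟨C (f 0), fun z _ => by simp [Subsingleton.elim z 0, hε.le]⟩
  | succ n ih =>
    intro f hf R ε hε
    rcases lt_or_ge R 0 with hR | hR
    · exact ⟨0, fun z hz => absurd (norm_nonneg z) (by linarith)⟩
    obtain ⟨M, hM⟩ := (isCompact_closedBall (0 : Fin (n + 1) → ℂ)
      (4 * (R + 1) + 1)).exists_bound_of_continuousOn hf.continuous.continuousOn
    let F : (Fin n → ℂ) → ℂ → ℂ := fun y t => f (Fin.cons t y)
    have hcons1 : ∀ t : ℂ, Differentiable ℂ fun y : Fin n → ℂ => (Fin.cons t y : Fin (n + 1) → ℂ) :=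
      fun t => differentiable_pi.2 fun i => by
        refine Fin.cases ?_ (fun i => ?_) i <;>
          simp only [Fin.cons_zero, Fin.cons_succ] <;> fun_prop
    have hcons2 : ∀ y : Fin n → ℂ, Differentiable ℂ fun t : ℂ => (Fin.cons t y : Fin (n + 1) → ℂ) :=
      fun y => differentiable_pi.2 fun i => by
        refine Fin.cases ?_ (fun i => ?_) i <;>
          simp only [Fin.cons_zero, Fin.cons_succ] <;> fun_prop
    have hbound : ∀ y, ‖y‖ ≤ R → ∀ t, ‖t‖ ≤ 4 * (R + 1) + 1 → ‖F y t‖ ≤ M := fun y hy t ht => by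
      refine hM _ ?_
      rw [mem_closedBall_zero_iff, pi_norm_le_iff_of_nonneg (by positivity)]
      refine Fin.cases (by simpa using ht) fun i => ?_
      rw [Fin.cons_succ]
      linarith [norm_le_pi_norm y i]
    have hM0 : 0 ≤ M := (norm_nonneg _).trans (hbound 0 (by simpa) 0 (by simp; positivity))
    obtain ⟨N, hN⟩ := exists_pow_lt_of_lt_one (show 0 < ε / (2 * (M + 1)) by positivity)
      (show (2 : ℝ)⁻¹ < 1 by norm_num)
    have hcoef : ∀ j : ℕ, Differentiable ℂ fun y => newtonSeq (F y) j (j + 1 : ℂ)⁻¹ := fun j =>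
      differentiable_newtonSeq_param (fun z => hf.comp (hcons1 z)) j _ fun i hi h => by
        have : (j : ℂ) = i := by simpa using h
        exact hi.ne' (by exact_mod_cast this)
    choose P hP using fun j : ℕ => ih _ (hcoef j) R (ε / (2 * (N + 1)) / (R + 1) ^ j)
      (by positivity)
    refine ⟨∑ j ∈ Finset.range N, (∏ i ∈ Finset.range j, (X 0 - C (i + 1 : ℂ)⁻¹)) *
      rename Fin.succ (P j), fun z hz => ?_⟩
    have hz0 : ‖z 0‖ ≤ R := (norm_le_pi_norm z 0).trans hz
    have htail : ‖Fin.tail z‖ ≤ R :=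
      (pi_norm_le_iff_of_nonneg hR).2 fun i => (norm_le_pi_norm z i.succ).trans hz
    have homega : ∀ j, ‖∏ i ∈ Finset.range j, (z 0 - (i + 1 : ℂ)⁻¹)‖ ≤ (R + 1) ^ j := fun j => by
      rw [norm_prod]
      refine (Finset.prod_le_prod (g := fun _ => R + 1) (fun _ _ => norm_nonneg _)
        fun i _ => ?_).trans (by simp)
      linarith [norm_sub_le (z 0) (i + 1 : ℂ)⁻¹, norm_inv_natCast_succ_le i]
    have hfz : f z = F (Fin.tail z) (z 0) := by simp [F]
    have heval : eval z (∑ j ∈ Finset.range N, (∏ i ∈ Finset.range j, (X 0 - C (i + 1 : ℂ)⁻¹)) *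
        rename Fin.succ (P j)) = ∑ j ∈ Finset.range N,
          (∏ i ∈ Finset.range j, (z 0 - (i + 1 : ℂ)⁻¹)) * eval (Fin.tail z) (P j) := by
      simp only [map_sum, map_mul, map_prod, map_sub, eval_X, eval_C, eval_rename]
      rfl
    rw [heval, hfz, eq_newton_sum_add (F (Fin.tail z)) N (z 0), add_sub_right_comm,
      ← Finset.sum_sub_distrib]
    have hrem : ‖(∏ i ∈ Finset.range N, (z 0 - (i + 1 : ℂ)⁻¹)) *
        newtonSeq (F (Fin.tail z)) N (z 0)‖ ≤ ε / 2 := by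
      have h1 := norm_newtonSeq_le (hf.comp (hcons2 (Fin.tail z))) hR (hbound _ htail) N (z 0)
        (by linarith)
      rw [norm_mul]
      calc _ ≤ (R + 1) ^ N * (M * ((2 * (R + 1))⁻¹) ^ N) :=
            mul_le_mul (homega N) h1 (norm_nonneg _) (by positivity)
        _ = M * (2⁻¹ : ℝ) ^ N := by
            rw [mul_inv, mul_pow, inv_pow (R + 1)]
            field_simp
        _ ≤ (M + 1) * (ε / (2 * (M + 1))) := by gcongr; linarith
        _ = ε / 2 := by field_simp
    have hterm : ∀ j ∈ Finset.range N, ‖(∏ i ∈ Finset.range j, (z 0 - (i + 1 : ℂ)⁻¹)) *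
        newtonSeq (F (Fin.tail z)) j (j + 1 : ℂ)⁻¹ -
        (∏ i ∈ Finset.range j, (z 0 - (i + 1 : ℂ)⁻¹)) * eval (Fin.tail z) (P j)‖ ≤
          ε / (2 * (N + 1)) := fun j _ => by
      rw [← mul_sub, norm_mul]
      calc _ ≤ (R + 1) ^ j * (ε / (2 * (N + 1)) / (R + 1) ^ j) :=
            mul_le_mul (homega j) (hP j _ htail) (norm_nonneg _) (by positivity)
        _ = _ := by field_simp
    have hsum := (norm_sum_le _ _).trans (Finset.sum_le_sum hterm)
    rw [Finset.sum_const, Finset.card_range, nsmul_eq_mul] at hsum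
    have hlast : (N : ℝ) * (ε / (2 * (N + 1))) ≤ ε / 2 := by
      calc (N : ℝ) * (ε / (2 * (N + 1))) ≤ (N + 1) * (ε / (2 * (N + 1))) := by gcongr; linarith
        _ = ε / 2 := by field_simp
    calc _ ≤ _ := norm_add_le _ _
      _ ≤ ε / 2 + ε / 2 := add_le_add (hsum.trans hlast) hrem
      _ = ε := add_halves ε

end EntireFunctions

section PaleyWiener

open Filter Topology Metric

variable {n : ℕ}

lemma norm_reOf_le (l : Fin n → ℂ) : ‖reOf l‖ ≤ ‖l‖ :=
  (pi_norm_le_iff_of_nonneg (norm_nonneg _)).2 fun i =>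
    (Complex.abs_re_le_norm (l i)).trans (norm_le_pi_norm l i)

lemma IsPW.add {f g : (Fin n → ℂ) → ℂ} (hf : IsPW f) (hg : IsPW g) :
    IsPW fun l => f l + g l := by
  refine ⟨hf.1.add hg.1, fun N k => ?_⟩
  obtain ⟨A, hA⟩ := hf.2 N k
  obtain ⟨B, hB⟩ := hg.2 N k
  refine ⟨A + B, fun l hl => ?_⟩
  calc (1 + ‖l‖) ^ N * ‖f l + g l‖ ≤ (1 + ‖l‖) ^ N * (‖f l‖ + ‖g l‖) := by
        gcongr
        exact norm_add_le _ _
    _ ≤ A + B := by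
        rw [mul_add]
        exact add_le_add (hA l hl) (hB l hl)

lemma IsPW.const_mul {f : (Fin n → ℂ) → ℂ} (hf : IsPW f) (a : ℂ) : IsPW fun l => a * f l := by
  refine ⟨hf.1.const_mul a, fun N k => ?_⟩
  obtain ⟨A, hA⟩ := hf.2 N k
  refine ⟨‖a‖ * A, fun l hl => ?_⟩
  rw [norm_mul, mul_left_comm]
  exact mul_le_mul_of_nonneg_left (hA l hl) (norm_nonneg a)

lemma IsPW.coord_mul {f : (Fin n → ℂ) → ℂ} (hf : IsPW f) (i : Fin n) :
    IsPW fun l => l i * f l := by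
  refine ⟨(differentiable_apply i).mul hf.1, fun N k => ?_⟩
  obtain ⟨A, hA⟩ := hf.2 (N + 1) k
  refine ⟨A, fun l hl => le_trans ?_ (hA l hl)⟩
  rw [norm_mul, pow_succ, mul_assoc]
  gcongr
  linarith [norm_le_pi_norm l i]

lemma IsPW.sum {ι : Type*} (s : Finset ι) {f : ι → (Fin n → ℂ) → ℂ} (hf : ∀ i, IsPW (f i)) :
    IsPW fun l => ∑ i ∈ s, f i l := by
  classical
  induction s using Finset.induction_on with
  | empty => exact ⟨by simp, fun N k => ⟨0, by simp⟩⟩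
  | insert i s hi ih =>
    simp_rw [Finset.sum_insert hi]
    exact (hf i).add ih

lemma IsPW.eval_mul (p : MvPolynomial (Fin n) ℂ) :
    ∀ {f : (Fin n → ℂ) → ℂ}, IsPW f → IsPW fun l => eval l p * f l := by
  induction p using MvPolynomial.induction_on with
  | C a =>
    intro f hf
    simpa using hf.const_mul a
  | add p q hp hq =>
    intro f hf
    simpa only [map_add, add_mul] using (hp hf).add (hq hf)
  | mul_X p i hp =>
    intro f hf
    simpa only [map_mul, eval_X, mul_assoc] using hp (hf.coord_mul i)

/-- Composition with the complexification of a real linear automorphism preserves `PW`. -/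
lemma IsPW.comp_linearEquiv {f : (Fin n → ℂ) → ℂ} (hf : IsPW f)
    {T : (Fin n → ℂ) ≃ₗ[ℂ] (Fin n → ℂ)}
    (hT : ∀ l : Fin n → ℂ, (∀ i, (l i).im = 0) → ∀ i, (T l i).im = 0) :
    IsPW fun l => f (T l) := by
  let T₁ : (Fin n → ℂ) →L[ℂ] (Fin n → ℂ) := LinearMap.toContinuousLinearMap T.toLinearMap
  let T₂ : (Fin n → ℂ) →L[ℂ] (Fin n → ℂ) := LinearMap.toContinuousLinearMap T.symm.toLinearMap
  have hnorm : ∀ l, 1 + ‖l‖ ≤ (1 + ‖T₂‖) * (1 + ‖T l‖) := fun l => by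
    have h : ‖l‖ ≤ ‖T₂‖ * ‖T l‖ := by simpa [T₂] using T₂.le_opNorm (T l)
    nlinarith [norm_nonneg T₂, norm_nonneg (T l)]
  have hre : ∀ l, ‖reOf (T l)‖ ≤ ‖T₁‖ * ‖reOf l‖ := fun l => by
    let a : Fin n → ℂ := fun i => (l i).re
    let b : Fin n → ℂ := fun i => (l i).im
    have hl : l = a + Complex.I • b := funext fun i => by
      simp [a, b, mul_comm Complex.I, Complex.re_add_im]
    have hreal : reOf (T l) = reOf (T a) := funext fun i => by
      have hb := hT b (fun i => Complex.ofReal_im _) i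
      conv_lhs => rw [hl]
      simp [reOf, hb]
    have ha : ‖a‖ ≤ ‖reOf l‖ := (pi_norm_le_iff_of_nonneg (norm_nonneg _)).2 fun i => by
      simpa [a, reOf] using norm_le_pi_norm (reOf l) i
    calc ‖reOf (T l)‖ ≤ ‖T₁ a‖ := hreal ▸ norm_reOf_le _
      _ ≤ ‖T₁‖ * ‖a‖ := T₁.le_opNorm a
      _ ≤ ‖T₁‖ * ‖reOf l‖ := by gcongr
  refine ⟨hf.1.comp T₁.differentiable, fun N k => ?_⟩
  obtain ⟨A, hA⟩ := hf.2 N (‖T₁‖ * k)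
  refine ⟨(1 + ‖T₂‖) ^ N * A, fun l hl => ?_⟩
  calc (1 + ‖l‖) ^ N * ‖f (T l)‖ ≤ ((1 + ‖T₂‖) * (1 + ‖T l‖)) ^ N * ‖f (T l)‖ := by
        gcongr
        exact hnorm l
    _ = (1 + ‖T₂‖) ^ N * ((1 + ‖T l‖) ^ N * ‖f (T l)‖) := by rw [mul_pow, mul_assoc]
    _ ≤ (1 + ‖T₂‖) ^ N * A := by
        gcongr
        exact hA _ ((hre l).trans (by gcongr))

/-- An entire quotient of a Paley–Wiener function by a nonzero polynomial is Paley–Wiener. -/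
lemma IsPW.of_eval_mul {D : MvPolynomial (Fin n) ℂ} (hD : D ≠ 0) {h : (Fin n → ℂ) → ℂ}
    (hd : Differentiable ℂ h) (hDh : IsPW fun l => eval l D * h l) : IsPW h := by
  obtain ⟨K, -, hK⟩ := exists_norm_le_of_norm_mul_le hD
  refine ⟨hd, fun N k => ?_⟩
  obtain ⟨A, hA⟩ := hDh.2 N (k + 1)
  refine ⟨K * (2 ^ N * |A|), fun l hl => ?_⟩
  have hpos : 0 < (1 + ‖l‖) ^ N := by positivity
  have hbound := hK h hd l (2 ^ N * |A| / (1 + ‖l‖) ^ N) fun μ hμ => by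
    rw [le_div_iff₀ hpos]
    have hre : ‖reOf μ‖ ≤ k + 1 := by
      have h1 : reOf μ = reOf l + reOf (μ - l) := funext fun i => by simp [reOf]
      rw [h1]
      exact (norm_add_le _ _).trans (add_le_add hl ((norm_reOf_le _).trans hμ))
    have hle : 1 + ‖l‖ ≤ 2 * (1 + ‖μ‖) := by
      have := norm_le_norm_add_norm_sub' l μ
      rw [norm_sub_rev] at this
      linarith [norm_nonneg μ]
    calc ‖eval μ D * h μ‖ * (1 + ‖l‖) ^ N ≤ ‖eval μ D * h μ‖ * (2 * (1 + ‖μ‖)) ^ N := by gcongr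
      _ = 2 ^ N * ((1 + ‖μ‖) ^ N * ‖eval μ D * h μ‖) := by rw [mul_pow]; ring
      _ ≤ 2 ^ N * |A| := by
          gcongr
          exact (hA μ hre).trans (le_abs_self A)
  calc (1 + ‖l‖) ^ N * ‖h l‖ ≤ (1 + ‖l‖) ^ N * (K * (2 ^ N * |A| / (1 + ‖l‖) ^ N)) := by gcongr
    _ = K * (2 ^ N * |A|) := by field_simp

variable {G : Type} [Group G] [Fintype G] {ρ : G →* ((Fin n → ℂ) ≃ₗ[ℂ] (Fin n → ℂ))}
  {ι : Type*} [Fintype ι] [DecidableEq ι] {p : ι → MvPolynomial (Fin n) ℂ}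
  {D : MvPolynomial (Fin n) ℂ} {N : ι → G → MvPolynomial (Fin n) ℂ}

/-- Cramer's rule for the coefficients of a decomposition with invariant coefficients. -/
lemma eval_mul_coeff_eq_sum
    (hN : ∀ i j, ∑ g, N i g * polynomialAction ρ g (p j) = if i = j then D else 0)
    {f : (Fin n → ℂ) → ℂ} {F : ι → (Fin n → ℂ) → ℂ} (hF : ∀ i g l, F i (ρ g l) = F i l)
    (hf : ∀ l, f l = ∑ j, eval l (p j) * F j l) (i : ι) (l : Fin n → ℂ) :
    eval l D * F i l = ∑ g, eval l (N i g) * f (ρ g⁻¹ l) := by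
  have h : ∀ j, (∑ g, eval l (N i g) * eval (ρ g⁻¹ l) (p j)) * F j l =
      if i = j then eval l D * F i l else 0 := fun j => by
    have := congrArg (eval l) (hN i j)
    simp only [map_sum, map_mul, eval_polynomialAction] at this
    rw [this]
    split_ifs with hij
    · rw [hij]
    · simp
  calc eval l D * F i l = ∑ j, (∑ g, eval l (N i g) * eval (ρ g⁻¹ l) (p j)) * F j l := by
        simp_rw [h, Finset.sum_ite_eq, Finset.mem_univ, if_true]
    _ = _ := by
        simp_rw [hf, hF, Finset.mul_sum, Finset.sum_mul]
        rw [Finset.sum_comm]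
        simp_rw [mul_assoc]

/-- The invariant coefficients depend continuously on the decomposed function. -/
lemma exists_norm_coeff_le (hD : D ≠ 0)
    (hN : ∀ i j, ∑ g, N i g * polynomialAction ρ g (p j) = if i = j then D else 0) (R : ℝ) :
    ∃ K R' : ℝ, 0 ≤ K ∧ ∀ (f : (Fin n → ℂ) → ℂ) (F : ι → (Fin n → ℂ) → ℂ),
      (∀ i, Differentiable ℂ (F i)) → (∀ i g l, F i (ρ g l) = F i l) →
      (∀ l, f l = ∑ j, eval l (p j) * F j l) → ∀ ε, 0 ≤ ε → (∀ l, ‖l‖ ≤ R' → ‖f l‖ ≤ ε) →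
      ∀ i l, ‖l‖ ≤ R → ‖F i l‖ ≤ K * ε := by
  obtain ⟨K, hK0, hK⟩ := exists_norm_le_of_norm_mul_le hD
  have hρ : ∀ g, Continuous (ρ g) := fun g => (ρ g).toLinearMap.continuous_of_finiteDimensional
  obtain ⟨B, hB⟩ := (isCompact_closedBall (0 : Fin n → ℂ) (R + 1)).exists_bound_of_continuousOn
    (f := fun μ => ∑ i, ∑ g, ‖eval μ (N i g)‖) (Continuous.continuousOn <|
      continuous_finsetSum _ fun i _ => continuous_finsetSum _ fun g _ =>
        (differentiable_eval (N i g)).continuous.norm)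
  obtain ⟨R', hR'⟩ := (isCompact_closedBall (0 : Fin n → ℂ) (R + 1)).exists_bound_of_continuousOn
    (f := fun μ => ∑ g, ‖ρ g⁻¹ μ‖) (Continuous.continuousOn <|
      continuous_finsetSum _ fun g _ => (hρ g⁻¹).norm)
  refine ⟨K * |B|, R', by positivity, fun f F hdiff hF hf ε hε hfε i l hl => ?_⟩
  rw [mul_assoc]
  refine hK (F i) (hdiff i) l _ fun μ hμ => ?_
  have hμR : μ ∈ closedBall (0 : Fin n → ℂ) (R + 1) := by
    rw [mem_closedBall_zero_iff]
    have := norm_le_norm_add_norm_sub' μ l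
    linarith
  have hsmall : ∀ g, ‖f (ρ g⁻¹ μ)‖ ≤ ε := fun g => hfε _ <|
    (Finset.single_le_sum (f := fun g => ‖ρ g⁻¹ μ‖) (fun _ _ => norm_nonneg _)
      (Finset.mem_univ g)).trans ((le_abs_self _).trans (hR' μ hμR))
  have hcoef : ∑ g, ‖eval μ (N i g)‖ ≤ |B| :=
    (Finset.single_le_sum (f := fun i => ∑ g, ‖eval μ (N i g)‖)
      (fun _ _ => Finset.sum_nonneg fun _ _ => norm_nonneg _) (Finset.mem_univ i)).trans
      ((le_abs_self _).trans ((hB μ hμR).trans (le_abs_self B)))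
  rw [eval_mul_coeff_eq_sum hN hF hf]
  calc ‖∑ g, eval μ (N i g) * f (ρ g⁻¹ μ)‖ ≤ ∑ g, ‖eval μ (N i g)‖ * ε :=
        norm_sum_le_of_le _ fun g _ => by
          rw [norm_mul]
          exact mul_le_mul_of_nonneg_left (hsmall g) (norm_nonneg _)
    _ = (∑ g, ‖eval μ (N i g)‖) * ε := by rw [Finset.sum_mul]
    _ ≤ |B| * ε := by gcongr

/-- A homogeneous basis of the polynomials over the invariants decomposes all entire functions. -/
lemma exists_entire_decomposition (hD : D ≠ 0)
    (hN : ∀ i j, ∑ g, N i g * polynomialAction ρ g (p j) = if i = j then D else 0)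
    (hspan : ∀ x, ∃ F : ι → MvPolynomial (Fin n) ℂ,
      (∀ i, IsInvariantUnder (polynomialAction ρ) (F i)) ∧ x = ∑ i, F i * p i)
    {f : (Fin n → ℂ) → ℂ} (hf : Differentiable ℂ f) :
    ∃ F : ι → (Fin n → ℂ) → ℂ, (∀ i, Differentiable ℂ (F i)) ∧ (∀ i g l, F i (ρ g l) = F i l) ∧
      ∀ l, f l = ∑ i, eval l (p i) * F i l := by
  choose T hT using fun k : ℕ => exists_polynomial_approx n f hf k (1 / ((k : ℝ) + 1))
    (by positivity)
  choose Q hQinv hQ using fun k => hspan (T k)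
  have hQinv' : ∀ k i g l, eval (ρ g l) (Q k i) = eval l (Q k i) := fun k i g l => by
    have h := congrArg (eval l) (hQinv k i g⁻¹)
    rwa [eval_polynomialAction, inv_inv] at h
  have hTeval : ∀ k l, eval l (T k) = ∑ i, eval l (p i) * eval l (Q k i) := fun k l => by
    rw [hQ k, map_sum]
    exact Finset.sum_congr rfl fun i _ => by rw [map_mul, mul_comm]
  have hcauchy : ∀ i, ∀ R : ℝ, ∀ ε > 0, ∃ M : ℕ, ∀ j ≥ M, ∀ k ≥ M, ∀ l, ‖l‖ ≤ R →
      ‖eval l (Q j i) - eval l (Q k i)‖ ≤ ε := fun i R ε hε => by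
    obtain ⟨K, R', hK0, hK⟩ := exists_norm_coeff_le hD hN R
    obtain ⟨M₁, hM₁⟩ := exists_nat_one_div_lt (show 0 < ε / (2 * (K + 1)) by positivity)
    obtain ⟨M₂, hM₂⟩ := exists_nat_ge R'
    have happrox : ∀ k ≥ max M₁ M₂, ∀ l, ‖l‖ ≤ R' →
        ‖f l - eval l (T k)‖ ≤ ε / (2 * (K + 1)) := fun k hk l hl => by
      have h1 : (M₁ : ℝ) ≤ k := by exact_mod_cast (le_max_left _ _).trans hk
      have h2 : (M₂ : ℝ) ≤ k := by exact_mod_cast (le_max_right _ _).trans hk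
      refine (hT k l (hl.trans (hM₂.trans h2))).trans (le_trans ?_ hM₁.le)
      gcongr
    refine ⟨max M₁ M₂, fun j hj k hk l hl => ?_⟩
    have h := hK (fun l => eval l (T j) - eval l (T k))
      (fun i l => eval l (Q j i) - eval l (Q k i))
      (fun i => (differentiable_eval _).sub (differentiable_eval _))
      (fun i g l => by rw [hQinv', hQinv'])
      (fun l => by simp_rw [hTeval, mul_sub, Finset.sum_sub_distrib])
      (ε / (K + 1)) (by positivity) (fun l hl => by
        have h1 := happrox j hj l hl
        have h2 := happrox k hk l hl
        rw [norm_sub_rev] at h1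
        calc _ = ‖(eval l (T j) - f l) + (f l - eval l (T k))‖ := by rw [sub_add_sub_cancel]
          _ ≤ ε / (2 * (K + 1)) + ε / (2 * (K + 1)) := norm_add_le_of_le h1 h2
          _ = ε / (K + 1) := by field_simp; ring) i l hl
    refine h.trans ?_
    rw [mul_div_assoc', div_le_iff₀ (by positivity)]
    linarith
  choose F hFd hFt using fun i =>
    exists_entire_tendsto (h := fun k l => eval l (Q k i)) (fun k => differentiable_eval _)
      (hcauchy i)
  refine ⟨F, hFd, fun i g l => ?_, fun l => ?_⟩
  · refine tendsto_nhds_unique (hFt i (ρ g l)) ?_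
    simpa only [hQinv'] using hFt i l
  · have h1 : Tendsto (fun k => eval l (T k)) atTop (𝓝 (∑ i, eval l (p i) * F i l)) := by
      simp_rw [hTeval]
      exact tendsto_finsetSum _ fun i _ => (hFt i l).const_mul _
    refine tendsto_nhds_unique ?_ h1
    rw [tendsto_iff_norm_sub_tendsto_zero]
    obtain ⟨M, hM⟩ := exists_nat_ge ‖l‖
    refine squeeze_zero' (Eventually.of_forall fun _ => norm_nonneg _) ?_
      tendsto_one_div_add_atTop_nhds_zero_nat
    filter_upwards [eventually_ge_atTop M] with k hk
    rw [norm_sub_rev]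
    exact hT k l (hM.trans (by exact_mod_cast hk))

/-- The invariant coefficients of a Paley–Wiener function are Paley–Wiener. -/
lemma IsPW.coeff (hD : D ≠ 0)
    (hN : ∀ i j, ∑ g, N i g * polynomialAction ρ g (p j) = if i = j then D else 0)
    (hreal : ∀ g, PreservesRealForm (ρ g).toLinearMap) {f : (Fin n → ℂ) → ℂ} (hf : IsPW f)
    {F : ι → (Fin n → ℂ) → ℂ} (hd : ∀ i, Differentiable ℂ (F i))
    (hF : ∀ i g l, F i (ρ g l) = F i l) (hfF : ∀ l, f l = ∑ j, eval l (p j) * F j l) (i : ι) :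
    IsPW (F i) := by
  refine .of_eval_mul hD (hd i) ?_
  simp_rw [eval_mul_coeff_eq_sum hN hF hfF i]
  exact .sum _ fun g => .eval_mul _ (hf.comp_linearEquiv (hreal g⁻¹).1)

lemma coeff_unique (hD : D ≠ 0)
    (hN : ∀ i j, ∑ g, N i g * polynomialAction ρ g (p j) = if i = j then D else 0)
    {f : (Fin n → ℂ) → ℂ} {F F' : ι → (Fin n → ℂ) → ℂ}
    (hd : ∀ i, Differentiable ℂ (F i)) (hF : ∀ i g l, F i (ρ g l) = F i l)
    (hfF : ∀ l, f l = ∑ j, eval l (p j) * F j l)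
    (hd' : ∀ i, Differentiable ℂ (F' i)) (hF' : ∀ i g l, F' i (ρ g l) = F' i l)
    (hfF' : ∀ l, f l = ∑ j, eval l (p j) * F' j l) : F = F' := by
  funext i l
  obtain ⟨K, R', -, hK⟩ := exists_norm_coeff_le hD hN ‖l‖
  have h := hK 0 (fun i l => F i l - F' i l) (fun i => (hd i).sub (hd' i))
    (fun i g l => by rw [hF, hF'])
    (fun l => by
      simp_rw [mul_sub, Finset.sum_sub_distrib]
      rw [← hfF, ← hfF', sub_self, Pi.zero_apply])
    0 le_rfl (by simp) i l le_rfl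
  rw [mul_zero] at h
  exact sub_eq_zero.1 (norm_le_zero_iff.1 h)

end PaleyWiener

/-- Rais's theorem for the Paley–Wiener space: `PW(V)` is a free module over the
`W`-invariants `PW(V)^W` with a homogeneous polynomial basis `p₁, …, p_{|W|}`. -/
theorem pw_free_over_invariants (n : ℕ) (G : Type) [Group G] [Fintype G]
    (ρ : G →* ((Fin n → ℂ) ≃ₗ[ℂ] (Fin n → ℂ)))
    (hfaithful : Function.Injective ρ)
    (hreal : ∀ g : G, PreservesRealForm (ρ g).toLinearMap)
    (hgen : ∃ S : Set G, Subgroup.closure S = ⊤ ∧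
      ∀ s ∈ S, IsReflection (ρ s).toLinearMap) :
    ∃ p : Fin (Fintype.card G) → MvPolynomial (Fin n) ℂ,
      (∀ i, (p i).IsHomogeneous ((p i).totalDegree)) ∧
      ∀ f : (Fin n → ℂ) → ℂ, IsPW f →
        ∃! F : Fin (Fintype.card G) → ((Fin n → ℂ) → ℂ),
          (∀ i, IsPW (F i) ∧ ∀ (g : G) (l : Fin n → ℂ), F i (ρ g l) = F i l) ∧
          ∀ l, f l = ∑ i, MvPolynomial.eval l (p i) * F i l := by
  obtain ⟨p, D, N, hp, hD, hN, hspan⟩ :=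
    (isReflectionAction_polynomialAction hgen).exists_homogeneous_basis
      (polynomialAction_injective hfaithful)
  refine ⟨p, hp, fun f hf => ?_⟩
  obtain ⟨F, hd, hF, hfF⟩ := exists_entire_decomposition hD hN hspan hf.1
  refine ⟨F, ⟨fun i => ⟨hf.coeff hD hN hreal hd hF hfF i, hF i⟩, hfF⟩, fun F' hF' => ?_⟩
  exact coeff_unique hD hN (fun i => (hF'.1 i).1.1) (fun i => (hF'.1 i).2) hF'.2 hd hF hfF
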